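/- Let k be a positive integer and let β, γ ∈ R^k. Then there exists a nonnegative integer N such that exactly one of the following holds: (1) there is a single chamber C of the chamber complex of cone(Δ+) with tβ + γ ∈ C for all real t ≥ N; or (2) tβ + γ ∉ cone(Δ+) for all real t ≥ N. -/

import Mathlib

/-!
STATEMENT 6: Let k be a positive integer and let β, γ ∈ R^k.  Then there exists a
nonnegative integer N such that exactly one of the following holds: (1) there is a single
chamber C of the chamber complex of cone(Δ+) with tβ + γ ∈ C for all real t ≥ N; or
(2) tβ + γ ∉ cone(Δ+) for all real t ≥ N.

Here Δ+ = {e_i − e_j : 1 ≤ i < j ≤ k} is the set of positive roots of type A_{k−1} and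
cone(S) denotes the set of nonnegative real combinations of elements of S.  The chamber
complex of cone(Δ+) is the common refinement of the cones cone(B) over the maximal linearly
independent subsets B ⊆ Δ+; its chambers (maximal cells) are characterized as follows: a
chamber is a full-dimensional set of the form ⋂ {cone(B) : B maximal independent ⊆ Δ+,
x ∈ cone(B)} for a point x of cone(Δ+), where full-dimensional means that its linear span
equals the linear span of Δ+.
-/

/-- The set of positive roots `Δ+ = {e_i - e_j : i < j}` of type `A_{k-1}`. -/
def posRoots (k : ℕ) : Set (Fin k → ℝ) :=
  {v | ∃ i j : Fin k, i < j ∧ v = Pi.single i (1 : ℝ) - Pi.single j (1 : ℝ)}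

/-- The cone of nonnegative real combinations of elements of `S`. -/
def coneOf {k : ℕ} (S : Set (Fin k → ℝ)) : Set (Fin k → ℝ) :=
  {x | ∃ (n : ℕ) (c : Fin n → ℝ) (u : Fin n → (Fin k → ℝ)),
    (∀ m, 0 ≤ c m) ∧ (∀ m, u m ∈ S) ∧ x = ∑ m, c m • u m}

/-- `B` is a maximal linearly independent subset of `Δ+`. -/
def IsMaxIndep (k : ℕ) (B : Set (Fin k → ℝ)) : Prop :=
  B ⊆ posRoots k ∧ LinearIndependent ℝ ((↑) : B → (Fin k → ℝ)) ∧
    ∀ B' : Set (Fin k → ℝ), B ⊆ B' → B' ⊆ posRoots k →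
      LinearIndependent ℝ ((↑) : B' → (Fin k → ℝ)) → B' = B

/-- `C` is a chamber (a maximal cell) of the chamber complex of `cone(Δ+)`: `C` is the
intersection of all the cones `cone(B)`, over maximal linearly independent `B ⊆ Δ+`,
containing some fixed point `x` of `cone(Δ+)`, and `C` is full-dimensional (its linear span
is all of the linear span of `Δ+`). -/
def IsChamber (k : ℕ) (C : Set (Fin k → ℝ)) : Prop :=
  (∃ x ∈ coneOf (posRoots k),
      C = ⋂₀ {D | ∃ B : Set (Fin k → ℝ), IsMaxIndep k B ∧ x ∈ coneOf B ∧ D = coneOf B}) ∧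
  Submodule.span ℝ C = Submodule.span ℝ (posRoots k)

open Filter Topology

lemma coneOf_mono {k : ℕ} {S T : Set (Fin k → ℝ)} (h : S ⊆ T) : coneOf S ⊆ coneOf T := by
  rintro x ⟨n, c, u, hc, hu, hx⟩
  exact ⟨n, c, u, hc, fun m => h (hu m), hx⟩

lemma coneOf_subset_span {k : ℕ} (S : Set (Fin k → ℝ)) :
    coneOf S ⊆ (Submodule.span ℝ S : Set (Fin k → ℝ)) := by
  rintro x ⟨n, c, u, -, hu, rfl⟩
  exact Submodule.sum_mem _ fun m _ => Submodule.smul_mem _ _ (Submodule.subset_span (hu m))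

lemma zero_mem_coneOf {k : ℕ} (S : Set (Fin k → ℝ)) : (0 : Fin k → ℝ) ∈ coneOf S :=
  ⟨0, fun _ => 0, fun _ => 0, fun m => m.elim0, fun m => m.elim0, by simp⟩

lemma add_mem_coneOf {k : ℕ} {S : Set (Fin k → ℝ)} {x y : Fin k → ℝ}
    (hx : x ∈ coneOf S) (hy : y ∈ coneOf S) : x + y ∈ coneOf S := by
  obtain ⟨n, c, u, hc, hu, rfl⟩ := hx
  obtain ⟨m, d, v, hd, hv, rfl⟩ := hy
  refine ⟨n + m, Fin.append c d, Fin.append u v, ?_, ?_, ?_⟩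
  · intro i
    induction i using Fin.addCases <;> simp [hc, hd]
  · intro i
    induction i using Fin.addCases <;> simp [hu, hv]
  · simp [Fin.sum_univ_add]

lemma smul_mem_coneOf {k : ℕ} {S : Set (Fin k → ℝ)} {x : Fin k → ℝ} {a : ℝ} (ha : 0 ≤ a)
    (hx : x ∈ coneOf S) : a • x ∈ coneOf S := by
  obtain ⟨n, c, u, hc, hu, rfl⟩ := hx
  exact ⟨n, fun m => a * c m, u, fun m => mul_nonneg ha (hc m), hu,
    by simp [Finset.smul_sum, mul_smul]⟩

lemma subset_coneOf {k : ℕ} (S : Set (Fin k → ℝ)) : S ⊆ coneOf S := fun x hx =>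
  ⟨1, fun _ => 1, fun _ => x, fun _ => zero_le_one, fun _ => hx, by simp⟩

lemma convex_coneOf {k : ℕ} (S : Set (Fin k → ℝ)) : Convex ℝ (coneOf S) :=
  fun _ hx _ hy _ _ ha hb _ => add_mem_coneOf (smul_mem_coneOf ha hx) (smul_mem_coneOf hb hy)

lemma mem_coneOf_finset_iff {k : ℕ} {t : Finset (Fin k → ℝ)} {x : Fin k → ℝ} :
    x ∈ coneOf (t : Set (Fin k → ℝ)) ↔
      ∃ c : (Fin k → ℝ) → ℝ, (∀ v ∈ t, 0 ≤ c v) ∧ ∑ v ∈ t, c v • v = x := by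
  classical
  constructor
  · rintro ⟨n, c, u, hc, hu, rfl⟩
    refine ⟨fun v => ∑ m with u m = v, c m, fun v _ => Finset.sum_nonneg fun m _ => hc m, ?_⟩
    rw [← Finset.sum_fiberwise_of_maps_to (t := t) (g := u) fun m _ => hu m]
    refine Finset.sum_congr rfl fun v _ => ?_
    rw [Finset.sum_smul]
    refine Finset.sum_congr rfl fun m hm => ?_
    rw [(Finset.mem_filter.1 hm).2]
  · rintro ⟨c, hc, rfl⟩
    refine Finset.sum_induction _ (· ∈ coneOf (t : Set (Fin k → ℝ)))
      (fun _ _ => add_mem_coneOf) (zero_mem_coneOf _) fun v hv => ?_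
    exact smul_mem_coneOf (hc v hv) (subset_coneOf _ hv)

/-- If `t` is linearly dependent, every element of its cone lies in the cone of a proper subset. -/
lemma exists_mem_coneOf_erase {k : ℕ} {t : Finset (Fin k → ℝ)} {x : Fin k → ℝ}
    (ht : ¬ LinearIndepOn ℝ id (t : Set (Fin k → ℝ))) (hx : x ∈ coneOf (t : Set (Fin k → ℝ))) :
    ∃ v ∈ t, x ∈ coneOf (t.erase v : Set (Fin k → ℝ)) := by
  obtain ⟨f, hf, hfx⟩ := mem_coneOf_finset_iff.1 hx
  obtain ⟨g, hg, i, hi, hgi⟩ : ∃ g : (Fin k → ℝ) → ℝ, ∑ v ∈ t, g v • v = 0 ∧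
      ∃ i ∈ t, 0 < g i := by
    rw [linearIndepOn_finset_iff] at ht
    push Not at ht
    obtain ⟨g, hg, i, hi, hgi⟩ := ht
    rcases lt_or_gt_of_ne hgi with h | h
    · exact ⟨-g, by simpa using hg, i, hi, by simpa using h⟩
    · exact ⟨g, by simpa using hg, i, hi, h⟩
  obtain ⟨v, hv, hmin⟩ := (t.filter fun v => 0 < g v).exists_min_image (fun v => f v / g v)
    ⟨i, Finset.mem_filter.2 ⟨hi, hgi⟩⟩
  obtain ⟨hvt, hgv⟩ := Finset.mem_filter.1 hv
  refine ⟨v, hvt, mem_coneOf_finset_iff.2 ⟨fun e => f e - f v / g v * g e, ?_, ?_⟩⟩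
  · intro e he
    have het := Finset.mem_of_mem_erase he
    rw [sub_nonneg]
    rcases lt_or_ge 0 (g e) with h | h
    · rw [← le_div_iff₀ h]
      exact hmin e (Finset.mem_filter.2 ⟨het, h⟩)
    · exact (mul_nonpos_of_nonneg_of_nonpos (div_nonneg (hf v hvt) hgv.le) h).trans (hf e het)
  · rw [Finset.sum_erase _ (by simp [hgv.ne'])]
    simp only [sub_smul, mul_smul, Finset.sum_sub_distrib, ← Finset.smul_sum, hg, hfx]
    simp

/-- Carathéodory's theorem for cones. -/
lemma exists_linearIndepOn_mem_coneOf {k : ℕ} {t : Finset (Fin k → ℝ)} {x : Fin k → ℝ}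
    (hx : x ∈ coneOf (t : Set (Fin k → ℝ))) :
    ∃ s ⊆ t, LinearIndepOn ℝ id (s : Set (Fin k → ℝ)) ∧ x ∈ coneOf (s : Set (Fin k → ℝ)) := by
  induction t using Finset.strongInduction with
  | H t ih =>
    by_cases ht : LinearIndepOn ℝ id (t : Set (Fin k → ℝ))
    · exact ⟨t, subset_rfl, ht, hx⟩
    · obtain ⟨v, hv, hxv⟩ := exists_mem_coneOf_erase ht hx
      obtain ⟨s, hs, h⟩ := ih _ (Finset.erase_ssubset hv) hxv
      exact ⟨s, hs.trans (Finset.erase_subset _ _), h⟩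

lemma finite_posRoots (k : ℕ) : (posRoots k).Finite := by
  refine (Set.finite_range fun p : Fin k × Fin k =>
    (Pi.single p.1 (1 : ℝ) - Pi.single p.2 (1 : ℝ) : Fin k → ℝ)).subset ?_
  rintro v ⟨i, j, -, rfl⟩
  exact ⟨(i, j), rfl⟩

lemma IsMaxIndep.posRoots_subset_span {k : ℕ} {B : Set (Fin k → ℝ)} (hB : IsMaxIndep k B) :
    posRoots k ⊆ (Submodule.span ℝ B : Set (Fin k → ℝ)) := by
  obtain ⟨b, hb, hBb, hsp, hli⟩ := exists_linearIndepOn_id_extension hB.2.1 hB.1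
  rwa [hB.2.2 b hBb hb hli] at hsp

lemma IsMaxIndep.span_eq {k : ℕ} {B : Set (Fin k → ℝ)} (hB : IsMaxIndep k B) :
    Submodule.span ℝ B = Submodule.span ℝ (posRoots k) :=
  le_antisymm (Submodule.span_mono hB.1) (Submodule.span_le.2 hB.posRoots_subset_span)

/-- The simplicial cones over the maximal independent sets of positive roots cover the root cone. -/
lemma exists_isMaxIndep_mem_coneOf {k : ℕ} {x : Fin k → ℝ} (hx : x ∈ coneOf (posRoots k)) :
    ∃ B, IsMaxIndep k B ∧ x ∈ coneOf B := by
  rw [← (finite_posRoots k).coe_toFinset] at hx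
  obtain ⟨s, hs, hli, hxs⟩ := exists_linearIndepOn_mem_coneOf hx
  obtain ⟨B, hB, hsB, hsp, hBli⟩ := exists_linearIndepOn_id_extension hli
    (show (s : Set (Fin k → ℝ)) ⊆ posRoots k from fun v hv => by simpa using hs hv)
  refine ⟨B, ⟨hB, hBli, fun B' hBB' hB' hli' => ?_⟩, coneOf_mono hsB hxs⟩
  refine (Set.Subset.antisymm hBB' fun v hv => ?_).symm
  by_contra hvB
  exact (LinearIndepOn.notMem_span_iff_id (s := B) (a := v) (K := ℝ) hBli).2
    ⟨LinearIndepOn.mono hli' (Set.insert_subset hv hBB'), hvB⟩ (hsp (hB' hv))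

/-- The coordinates with respect to a linearly independent set, extended to the whole space,
cut out its cone inside its span. -/
lemma exists_coord {k : ℕ} {B : Set (Fin k → ℝ)} (hB : LinearIndepOn ℝ id B) :
    ∃ f : (Fin k → ℝ) → ((Fin k → ℝ) →ₗ[ℝ] ℝ), (∀ b ∈ B, f b b = 1) ∧
      ∀ x ∈ Submodule.span ℝ B, x ∈ coneOf B ↔ ∀ b ∈ B, 0 ≤ f b x := by
  classical
  have hdual : ∀ b : Fin k → ℝ, ∃ φ : (Fin k → ℝ) →ₗ[ℝ] ℝ,
      ∀ c ∈ B, φ c = if c = b then 1 else 0 := by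
    intro b
    let bas := Module.Basis.extend hB
    refine ⟨bas.constr ℝ fun c => if (c : Fin k → ℝ) = b then 1 else 0, fun c hc => ?_⟩
    have hcb : bas ⟨c, hB.subset_extend _ hc⟩ = c := Module.Basis.extend_apply_self hB _
    conv_lhs => rw [← hcb]
    rw [Module.Basis.constr_basis]
  choose f hf using hdual
  have hfin : B.Finite := hB.linearIndependent.set_finite_of_isNoetherian
  have key : ∀ c : (Fin k → ℝ) → ℝ, ∀ b ∈ B, f b (∑ v ∈ hfin.toFinset, c v • v) = c b := by
    intro c b hb
    rw [map_sum, Finset.sum_eq_single_of_mem b (by simpa using hb)]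
    · simp [hf b b hb]
    · intro v hv hvb
      simp [hf b v (by simpa using hv), hvb]
  refine ⟨f, fun b hb => by simp [hf b b hb], fun x hx => ⟨fun hxB b hb => ?_, fun h => ?_⟩⟩
  · rw [← hfin.coe_toFinset] at hxB
    obtain ⟨c, hc, rfl⟩ := mem_coneOf_finset_iff.1 hxB
    rw [key c b hb]
    exact hc b (by simpa using hb)
  · rw [← hfin.coe_toFinset] at hx
    obtain ⟨c, -, rfl⟩ := Submodule.mem_span_finset.1 hx
    have : ∑ v ∈ hfin.toFinset, c v • v ∈ coneOf (hfin.toFinset : Set (Fin k → ℝ)) :=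
      mem_coneOf_finset_iff.2 ⟨c, fun v hv => by
        rw [← key c v (by simpa using hv)]
        exact h v (by simpa using hv), rfl⟩
    rwa [hfin.coe_toFinset] at this

lemma eventually_add_mul_ne_zero {a b : ℝ} (h : a ≠ 0 ∨ b ≠ 0) :
    ∀ᶠ ε in 𝓝[>] (0 : ℝ), a + ε * b ≠ 0 := by
  by_cases ha : a = 0
  · filter_upwards [self_mem_nhdsWithin] with ε hε
    have hε : ε ≠ 0 := ne_of_gt hε
    simpa [ha, hε] using h
  · have : Tendsto (fun ε : ℝ => a + ε * b) (𝓝[>] 0) (𝓝 (a + 0 * b)) :=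
      (Continuous.tendsto (by fun_prop) 0).mono_left nhdsWithin_le_nhds
    exact this.eventually_ne (by simpa using ha)

lemma eventually_add_mul_pos {a : ℝ} (ha : 0 < a) (b : ℝ) :
    ∀ᶠ ε in 𝓝[>] (0 : ℝ), 0 < a + ε * b := by
  have : Tendsto (fun ε : ℝ => a + ε * b) (𝓝[>] 0) (𝓝 (a + 0 * b)) :=
    (Continuous.tendsto (by fun_prop) 0).mono_left nhdsWithin_le_nhds
  exact this.eventually_const_lt (by simpa using ha)

/-- The cone over `S` is not contained in a finite union of hyperplanes not containing `S`. -/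
lemma exists_mem_coneOf_forall_ne_zero {k : ℕ} {S : Set (Fin k → ℝ)} {ι : Type*} {s : Set ι}
    (hs : s.Finite) (φ : ι → ((Fin k → ℝ) →ₗ[ℝ] ℝ)) (hφ : ∀ i ∈ s, ∃ r ∈ S, φ i r ≠ 0) :
    ∃ w ∈ coneOf S, ∀ i ∈ s, φ i w ≠ 0 := by
  induction s, hs using Set.Finite.induction_on with
  | empty => exact ⟨0, zero_mem_coneOf S, by simp⟩
  | @insert i s hi hs ih =>
    obtain ⟨w, hw, hws⟩ := ih fun j hj => hφ j (Set.mem_insert_of_mem _ hj)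
    obtain ⟨r, hr, hir⟩ := hφ i (Set.mem_insert _ _)
    have h : ∀ᶠ ε in 𝓝[>] (0 : ℝ), ∀ j ∈ insert i s, φ j w + ε * φ j r ≠ 0 := by
      rw [eventually_all_finite (hs.insert i)]
      rintro j (rfl | hj)
      · exact eventually_add_mul_ne_zero (Or.inr hir)
      · exact eventually_add_mul_ne_zero (Or.inl (hws j hj))
    obtain ⟨ε, hε, hε0⟩ := (h.and self_mem_nhdsWithin).exists
    refine ⟨w + ε • r, add_mem_coneOf hw (smul_mem_coneOf (le_of_lt hε0) (subset_coneOf S hr)), ?_⟩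
    intro j hj
    simpa using hε j hj

/-- An affine function of one variable has eventually constant sign. -/
lemma eventually_affine_sign (a b : ℝ) :
    (∀ᶠ t in atTop, 0 ≤ t * a + b) ∨ ∀ᶠ t in atTop, t * a + b < 0 := by
  rcases lt_trichotomy a 0 with ha | rfl | ha
  · exact Or.inr ((tendsto_atBot_add_const_right _ b
      (tendsto_id.atTop_mul_const_of_neg ha)).eventually_lt_atBot 0)
  · rcases le_or_gt 0 b with hb | hb
    · exact Or.inl (by simp [hb])
    · exact Or.inr (by simp [hb])
  · exact Or.inl ((tendsto_atTop_add_const_right _ b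
      (tendsto_id.atTop_mul_const ha)).eventually_ge_atTop 0)

lemma Convex.eventually_mem_or_eventually_notMem {s : Set ℝ} (hs : Convex ℝ s) :
    (∀ᶠ t in atTop, t ∈ s) ∨ ∀ᶠ t in atTop, t ∉ s := by
  by_cases h : BddAbove s
  · obtain ⟨M, hM⟩ := h
    exact Or.inr ((eventually_gt_atTop M).mono fun t ht hts => (hM hts).not_gt ht)
  · left
    obtain ⟨a, ha, -⟩ := not_bddAbove_iff.1 h 0
    filter_upwards [eventually_ge_atTop a] with t ht
    obtain ⟨b, hb, htb⟩ := not_bddAbove_iff.1 h t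
    exact hs.ordConnected.out ha hb ⟨ht, htb.le⟩

lemma IsChamber.subset_coneOf {k : ℕ} {C : Set (Fin k → ℝ)} (hC : IsChamber k C) :
    C ⊆ coneOf (posRoots k) := by
  obtain ⟨⟨x, hx, rfl⟩, -⟩ := hC
  obtain ⟨B, hB, hxB⟩ := exists_isMaxIndep_mem_coneOf hx
  exact fun y hy => coneOf_mono hB.1 (hy _ ⟨B, hB, hxB, rfl⟩)

lemma finite_isMaxIndep_pairs (k : ℕ) :
    {p : Set (Fin k → ℝ) × (Fin k → ℝ) | IsMaxIndep k p.1 ∧ p.2 ∈ p.1}.Finite :=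
  ((finite_posRoots k).finite_subsets.prod (finite_posRoots k)).subset
    fun _ hp => ⟨hp.1.1, hp.1.1 hp.2⟩

/-- A ray that eventually lies in the root cone eventually lies in a single chamber. -/
lemma exists_isChamber_of_eventually_mem {k : ℕ} {β γ : Fin k → ℝ}
    (h : ∀ᶠ t : ℝ in atTop, t • β + γ ∈ coneOf (posRoots k)) :
    ∃ C, IsChamber k C ∧ ∀ᶠ t : ℝ in atTop, t • β + γ ∈ C := by
  have hcoord : ∀ B : Set (Fin k → ℝ), ∃ f : (Fin k → ℝ) → ((Fin k → ℝ) →ₗ[ℝ] ℝ),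
      IsMaxIndep k B → (∀ b ∈ B, f b b = 1) ∧
        ∀ x ∈ Submodule.span ℝ B, x ∈ coneOf B ↔ ∀ b ∈ B, 0 ≤ f b x := by
    intro B
    by_cases hB : IsMaxIndep k B
    · obtain ⟨f, hf⟩ := exists_coord hB.2.1
      exact ⟨f, fun _ => hf⟩
    · exact ⟨0, fun h => absurd h hB⟩
  choose f hf using hcoord
  have mem_iff : ∀ {B x}, IsMaxIndep k B → x ∈ Submodule.span ℝ (posRoots k) →
      (x ∈ coneOf B ↔ ∀ b ∈ B, 0 ≤ f B b x) := fun hB hx =>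
    (hf _ hB).2 _ (by rwa [hB.span_eq])
  have hfin := finite_isMaxIndep_pairs k
  obtain ⟨w, hw, hw0⟩ := exists_mem_coneOf_forall_ne_zero (S := posRoots k) hfin
    (fun p => f p.1 p.2) fun p hp => ⟨p.2, hp.1.1 hp.2, by simp [(hf _ hp.1).1 _ hp.2]⟩
  -- beyond `T`, no coordinate of a point of the ray changes sign
  obtain ⟨T, hT⟩ : ∃ T : ℝ, ∀ t ≥ T, t • β + γ ∈ coneOf (posRoots k) ∧
      ∀ p ∈ {p : Set (Fin k → ℝ) × (Fin k → ℝ) | IsMaxIndep k p.1 ∧ p.2 ∈ p.1},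
        0 ≤ f p.1 p.2 (T • β + γ) → 0 ≤ f p.1 p.2 (t • β + γ) := by
    have hsign : ∀ᶠ T : ℝ in atTop,
        ∀ p ∈ {p : Set (Fin k → ℝ) × (Fin k → ℝ) | IsMaxIndep k p.1 ∧ p.2 ∈ p.1},
          ∀ t ≥ T, 0 ≤ f p.1 p.2 (T • β + γ) → 0 ≤ f p.1 p.2 (t • β + γ) := by
      rw [eventually_all_finite hfin]
      intro p _
      simp only [map_add, map_smul, smul_eq_mul]
      rcases eventually_affine_sign (f p.1 p.2 β) (f p.1 p.2 γ) with h' | h'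
      · filter_upwards [eventually_forall_ge_atTop.2 h'] with T hT t ht _ using hT t ht
      · filter_upwards [h'] with T hT t _ h0 using absurd hT h0.not_gt
    obtain ⟨T, h1, h2⟩ := ((eventually_forall_ge_atTop.2 h).and hsign).exists
    exact ⟨T, fun t ht => ⟨h1 t ht, fun p hp => h2 p hp t ht⟩⟩
  -- a point near the ray, in generic position
  obtain ⟨ε, hε, hε0⟩ : ∃ ε > 0,
      ∀ p ∈ {p : Set (Fin k → ℝ) × (Fin k → ℝ) | IsMaxIndep k p.1 ∧ p.2 ∈ p.1},
        f p.1 p.2 (T • β + γ) + ε * f p.1 p.2 w ≠ 0 ∧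
          (0 ≤ f p.1 p.2 (T • β + γ) + ε * f p.1 p.2 w → 0 ≤ f p.1 p.2 (T • β + γ)) := by
    have : ∀ᶠ ε in 𝓝[>] (0 : ℝ),
        ∀ p ∈ {p : Set (Fin k → ℝ) × (Fin k → ℝ) | IsMaxIndep k p.1 ∧ p.2 ∈ p.1},
          f p.1 p.2 (T • β + γ) + ε * f p.1 p.2 w ≠ 0 ∧
            (0 ≤ f p.1 p.2 (T • β + γ) + ε * f p.1 p.2 w → 0 ≤ f p.1 p.2 (T • β + γ)) := by
      rw [eventually_all_finite hfin]
      intro p hp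
      refine (eventually_add_mul_ne_zero (Or.inr (hw0 p hp))).and ?_
      rcases le_or_gt 0 (f p.1 p.2 (T • β + γ)) with h0 | h0
      · exact Eventually.of_forall fun _ _ => h0
      · filter_upwards [eventually_add_mul_pos (neg_pos.2 h0) (-(f p.1 p.2 w))] with ε hε h1
        linarith
    obtain ⟨ε, h1, h2⟩ := (this.and self_mem_nhdsWithin).exists
    exact ⟨ε, h2, h1⟩
  set x := T • β + γ + ε • w with hx
  have hfx : ∀ p : Set (Fin k → ℝ) × (Fin k → ℝ),
      f p.1 p.2 x = f p.1 p.2 (T • β + γ) + ε * f p.1 p.2 w := fun p => by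
    rw [hx, map_add _ (T • β + γ), map_smul, smul_eq_mul]
  have hxcone : x ∈ coneOf (posRoots k) :=
    add_mem_coneOf (hT T le_rfl).1 (smul_mem_coneOf hε.le hw)
  have hxspan := coneOf_subset_span _ hxcone
  have hpos : ∀ p ∈ {p : Set (Fin k → ℝ) × (Fin k → ℝ) | IsMaxIndep k p.1 ∧ p.2 ∈ p.1},
      x ∈ coneOf p.1 → 0 < f p.1 p.2 x := fun p hp hxp =>
    lt_of_le_of_ne ((mem_iff hp.1 hxspan).1 hxp _ hp.2) (hfx p ▸ (hε0 p hp).1.symm)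
  refine ⟨⋂₀ {D | ∃ B : Set (Fin k → ℝ), IsMaxIndep k B ∧ x ∈ coneOf B ∧ D = coneOf B},
    ⟨⟨x, hxcone, rfl⟩, le_antisymm ?_ ?_⟩, ?_⟩
  · obtain ⟨B, hB, hxB⟩ := exists_isMaxIndep_mem_coneOf hxcone
    refine Submodule.span_le.2 fun y hy => ?_
    exact coneOf_subset_span _ (coneOf_mono hB.1 (hy _ ⟨B, hB, hxB, rfl⟩))
  · refine Submodule.span_le.2 fun v hv => ?_
    have hδ : ∀ᶠ δ in 𝓝[>] (0 : ℝ),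
        ∀ p ∈ {p : Set (Fin k → ℝ) × (Fin k → ℝ) | IsMaxIndep k p.1 ∧ p.2 ∈ p.1},
          x ∈ coneOf p.1 → 0 < f p.1 p.2 x + δ * f p.1 p.2 v := by
      rw [eventually_all_finite hfin]
      intro p hp
      by_cases hxp : x ∈ coneOf p.1
      · exact (eventually_add_mul_pos (hpos p hp hxp) _).mono fun _ hδ _ => hδ
      · exact Eventually.of_forall fun _ h => absurd h hxp
    obtain ⟨δ, hδ, hδ0⟩ := (hδ.and self_mem_nhdsWithin).exists
    have hmem : x + δ • v ∈
        ⋂₀ {D | ∃ B : Set (Fin k → ℝ), IsMaxIndep k B ∧ x ∈ coneOf B ∧ D = coneOf B} := by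
      rintro _ ⟨B, hB, hxB, rfl⟩
      rw [mem_iff hB (add_mem hxspan (Submodule.smul_mem _ _ (Submodule.subset_span hv)))]
      intro b hb
      simpa using (hδ (B, b) ⟨hB, hb⟩ hxB).le
    have hxmem : x ∈
        ⋂₀ {D | ∃ B : Set (Fin k → ℝ), IsMaxIndep k B ∧ x ∈ coneOf B ∧ D = coneOf B} := by
      rintro _ ⟨B, -, hxB, rfl⟩
      exact hxB
    have hsub := sub_mem (Submodule.subset_span (R := ℝ) hmem) (Submodule.subset_span hxmem)
    rw [add_sub_cancel_left] at hsub
    exact (Submodule.smul_mem_iff _ (ne_of_gt hδ0)).1 hsub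
  · filter_upwards [eventually_ge_atTop T] with t ht
    rintro _ ⟨B, hB, hxB, rfl⟩
    rw [mem_iff hB (coneOf_subset_span _ (hT t ht).1)]
    intro b hb
    have hp : (B, b) ∈
        {p : Set (Fin k → ℝ) × (Fin k → ℝ) | IsMaxIndep k p.1 ∧ p.2 ∈ p.1} := ⟨hB, hb⟩
    exact (hT t ht).2 _ hp ((hε0 _ hp).2 (hfx (B, b) ▸ (hpos _ hp hxB).le))

lemma exists_nat_of_eventually_atTop {P : ℝ → Prop} (h : ∀ᶠ t in atTop, P t) :
    ∃ N : ℕ, ∀ t : ℝ, (N : ℝ) ≤ t → P t := by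
  obtain ⟨a, ha⟩ := eventually_atTop.1 h
  obtain ⟨N, hN⟩ := exists_nat_ge a
  exact ⟨N, fun t ht => ha t (hN.trans ht)⟩

/-- For any `β, γ ∈ ℝ^k` there is a nonnegative integer `N` such that exactly one of the
following holds: the ray `t ↦ tβ + γ` lies in one single chamber of the chamber complex for
all real `t ≥ N`, or it lies outside `cone(Δ+)` for all real `t ≥ N`. -/
theorem stmt6 (k : ℕ) (hk : 0 < k) (β γ : Fin k → ℝ) :
    ∃ N : ℕ, Xor'
      (∃ C : Set (Fin k → ℝ), IsChamber k C ∧ ∀ t : ℝ, (N : ℝ) ≤ t → t • β + γ ∈ C)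
      (∀ t : ℝ, (N : ℝ) ≤ t → t • β + γ ∉ coneOf (posRoots k)) := by
  have hconv : Convex ℝ {t : ℝ | t • β + γ ∈ coneOf (posRoots k)} := by
    intro s hs t ht a b ha hb hab
    have h := convex_coneOf (posRoots k) hs ht ha hb hab
    have heq : a • (s • β + γ) + b • (t • β + γ) = (a • s + b • t) • β + (a + b) • γ := by
      simp only [smul_eq_mul]
      module
    rwa [heq, hab, one_smul] at h
  rcases hconv.eventually_mem_or_eventually_notMem with h | h
  · obtain ⟨C, hC, hmem⟩ := exists_isChamber_of_eventually_mem h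
    obtain ⟨N, hN⟩ := exists_nat_of_eventually_atTop hmem
    exact ⟨N, Or.inl ⟨⟨C, hC, hN⟩, fun h' => h' N le_rfl (hC.subset_coneOf (hN N le_rfl))⟩⟩
  · obtain ⟨N, hN⟩ := exists_nat_of_eventually_atTop h
    refine ⟨N, Or.inr ⟨hN, ?_⟩⟩
    rintro ⟨C, hC, hmem⟩
    exact hN N le_rfl (hC.subset_coneOf (hmem N le_rfl))
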